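/- Let F be a pointwise almost periodic decomposition of a compact Hausdorff topological space X. Then F is R-closed if and only if for every x ∈ X and every open neighbourhood U of the class F̂(x) there is an open F̂-saturated neighbourhood of F̂(x) contained in U. -/

import Mathlib

open Set Topology

/-- The class of `x` in the decomposition `F`. -/
def Fhat {X : Type*} [TopologicalSpace X] (F : X → Set X) (x : X) : Set X :=
  {y | closure (F y) = closure (F x)}

/-- In a pointwise almost periodic decomposition the classes are the closures of the elements. -/
theorem Fhat_eq_closure {X : Type*} [TopologicalSpace X] (F : X → Set X)
    (hmem : ∀ x, x ∈ F x)
    (hpap : ∀ x y, closure (F x) = closure (F y) ∨ Disjoint (closure (F x)) (closure (F y)))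
    (x : X) : Fhat F x = closure (F x) := by
  ext y
  have hy : y ∈ closure (F y) := subset_closure (hmem y)
  refine ⟨fun h => ?_, fun h => ?_⟩
  · have h' : closure (F y) = closure (F x) := h
    exact h' ▸ hy
  · exact (hpap y x).resolve_right fun hd => disjoint_left.1 hd hy h

/-- A pointwise almost periodic decomposition of a compact Hausdorff space is `R`-closed
if and only if every class `F̂(x)` admits arbitrarily small open `F̂`-saturated
neighbourhoods. -/
theorem stmt6 {X : Type*} [TopologicalSpace X] [CompactSpace X] [T2Space X]
    (F : X → Set X)
    (hmem : ∀ x, x ∈ F x)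
    (hpart : ∀ x y, y ∈ F x → F y = F x)
    (hpap : ∀ x y, closure (F x) = closure (F y) ∨ Disjoint (closure (F x)) (closure (F y))) :
    IsClosed {p : X × X | p.2 ∈ closure (F p.1)} ↔
      ∀ x, ∀ U : Set X, IsOpen U → Fhat F x ⊆ U →
        ∃ V : Set X, IsOpen V ∧ Fhat F x ⊆ V ∧ V ⊆ U ∧ ∀ y ∈ V, Fhat F y ⊆ V := by
  have hF := Fhat_eq_closure F hmem hpap
  constructor
  · intro hR x U hU hxU
    have hclosed : IsClosed (Prod.fst '' ({p : X × X | p.2 ∈ closure (F p.1)} ∩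
        Prod.snd ⁻¹' Uᶜ)) :=
      isClosedMap_fst_of_compactSpace _ (hR.inter (hU.isClosed_compl.preimage continuous_snd))
    have hV : (Prod.fst '' ({p : X × X | p.2 ∈ closure (F p.1)} ∩ Prod.snd ⁻¹' Uᶜ))ᶜ =
        {y | Fhat F y ⊆ U} := by
      ext y
      simp [hF, subset_def]
    have hsat : ∀ y ∈ {y | Fhat F y ⊆ U}, Fhat F y ⊆ {y | Fhat F y ⊆ U} := by
      intro y hy z hz w hw
      exact hy (Eq.trans hw hz)
    refine ⟨{y | Fhat F y ⊆ U}, hV ▸ hclosed.isOpen_compl, hsat x hxU, fun y hy => hy rfl, hsat⟩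
  · intro h
    rw [← isOpen_compl_iff, isOpen_prod_iff]
    intro x y hxy
    have hd : Disjoint (closure (F x)) {y} := disjoint_singleton_right.2 hxy
    obtain ⟨U, W, hU, hW, hxU, hyW, hUW⟩ :=
      SeparatedNhds.of_isCompact_isCompact isClosed_closure.isCompact isCompact_singleton hd
    obtain ⟨V, hV, hxV, hVU, hsat⟩ := h x U hU ((hF x).trans_subset hxU)
    refine ⟨V, W, hV, hW, hxV rfl, hyW rfl, ?_⟩
    rintro ⟨a, b⟩ ⟨ha, hb⟩ hab
    exact disjoint_left.1 hUW (hVU (hsat a ha ((hF a).symm ▸ hab))) hb
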